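/- Let X_1,…,X_K be mutually independent finitely-valued random variables and let (X_1,…,X_K,Y,Z) be jointly distributed. Let 𝒦₀ ⊆ 𝒦′ ⊆ 𝒦, write 𝒦̄′ = 𝒦∖𝒦′, and assume I(X_{𝒦₀};Y|X_{𝒦∖𝒦₀}) − I(X_{𝒦₀};Z|X_{𝒦̄′}) ≤ 0. Then for every nonempty V ⊆ 𝒦′∖𝒦₀, I(X_{𝒦₀∪V};Y|X_{𝒦∖(𝒦₀∪V)}) − I(X_{𝒦₀∪V};Z|X_{𝒦̄′}) ≤ I(X_V;Y|X_{𝒦∖V}) − I(X_V;Z|X_{𝒦̄′∪𝒦₀}). -/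

import Mathlib

open scoped Classical

noncomputable section

/-- Probability that random variable `X` takes value `x`, under pmf `p` on a finite sample space. -/
def probOf {Ω α : Type} [Fintype Ω] (p : Ω → ℝ) (X : Ω → α) (x : α) : ℝ :=
  ∑ ω, if X ω = x then p ω else 0

/-- Shannon entropy of a finitely-valued random variable. -/
def Hent {Ω α : Type} [Fintype Ω] [Fintype α] (p : Ω → ℝ) (X : Ω → α) : ℝ :=
  -∑ x, probOf p X x * Real.log (probOf p X x)

/-- Conditional entropy `H(X | C)`. -/
def condHent {Ω α γ : Type} [Fintype Ω] [Fintype α] [Fintype γ]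
    (p : Ω → ℝ) (X : Ω → α) (C : Ω → γ) : ℝ :=
  Hent p (fun ω => (X ω, C ω)) - Hent p C

/-- Conditional mutual information `I(A;B | C)`. -/
def IcondMut {Ω α β γ : Type} [Fintype Ω] [Fintype α] [Fintype β] [Fintype γ]
    (p : Ω → ℝ) (A : Ω → α) (B : Ω → β) (C : Ω → γ) : ℝ :=
  condHent p A C + condHent p B C - condHent p (fun ω => (A ω, B ω)) C

/-- Mutual information `I(A;B)`. -/
def Imut {Ω α β : Type} [Fintype Ω] [Fintype α] [Fintype β]
    (p : Ω → ℝ) (A : Ω → α) (B : Ω → β) : ℝ :=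
  Hent p A + Hent p B - Hent p (fun ω => (A ω, B ω))

/-- `p` is a probability mass function. -/
def IsPMF {Ω : Type} [Fintype Ω] (p : Ω → ℝ) : Prop :=
  (∀ ω, 0 ≤ p ω) ∧ ∑ ω, p ω = 1

/-- The tuple `X_S = (X_k)_{k ∈ S}` as a random variable. -/
def tup {Ω ι : Type} {𝒳 : ι → Type} (X : ∀ k, Ω → 𝒳 k) (S : Finset ι) :
    Ω → ∀ k : S, 𝒳 k.1 :=
  fun ω k => X k.1 ω

/-- The random variables `X_1, …, X_K` are mutually independent. -/
def MutIndep {Ω ι : Type} [Fintype Ω] [Fintype ι] {𝒳 : ι → Type} [∀ k, Fintype (𝒳 k)]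
    (p : Ω → ℝ) (X : ∀ k, Ω → 𝒳 k) : Prop :=
  ∀ x : ∀ k, 𝒳 k, probOf p (fun ω k => X k ω) x = ∏ k, probOf p (X k) (x k)

section Entropy

variable {Ω α β γ : Type} [Fintype Ω]

lemma probOf_nonneg {p : Ω → ℝ} (hp : IsPMF p) (X : Ω → α) (x : α) : 0 ≤ probOf p X x :=
  Finset.sum_nonneg fun ω _ => by split_ifs <;> simp [hp.1 ω]

lemma probOf_pos {p : Ω → ℝ} (hp : IsPMF p) (X : Ω → α) {ω : Ω} (hω : 0 < p ω) :
    0 < probOf p X (X ω) := by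
  refine Finset.sum_pos' (fun ω' _ => ?_) ⟨ω, Finset.mem_univ _, by simpa using hω⟩
  split_ifs <;> simp [hp.1 ω']

lemma sum_probOf_mul [Fintype α] (p : Ω → ℝ) (X : Ω → α) (f : α → ℝ) :
    ∑ x, probOf p X x * f x = ∑ ω, p ω * f (X ω) := by
  simp only [probOf, Finset.sum_mul, ite_mul, zero_mul]
  rw [Finset.sum_comm]
  simp

lemma sum_probOf [Fintype α] {p : Ω → ℝ} (hp : IsPMF p) (X : Ω → α) :
    ∑ x, probOf p X x = 1 := by
  simpa [hp.2] using sum_probOf_mul p X fun _ => 1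

lemma sum_probOf_prodMk [Fintype α] (p : Ω → ℝ) (A : Ω → α) (C : Ω → γ) (c : γ) :
    ∑ a, probOf p (fun ω => (A ω, C ω)) (a, c) = probOf p C c := by
  simp only [probOf]
  rw [Finset.sum_comm]
  refine Finset.sum_congr rfl fun ω _ => ?_
  by_cases h : C ω = c <;> simp [h]

lemma Hent_eq_sum [Fintype α] (p : Ω → ℝ) (X : Ω → α) :
    Hent p X = -∑ ω, p ω * Real.log (probOf p X (X ω)) := by
  rw [Hent, sum_probOf_mul p X fun x => Real.log (probOf p X x)]

/-- Entropy depends only on the partition of the sample space induced by the variable. -/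
lemma Hent_congr [Fintype α] [Fintype β] (p : Ω → ℝ) {X : Ω → α} {X' : Ω → β}
    (h : ∀ ω ω', X ω = X ω' ↔ X' ω = X' ω') : Hent p X = Hent p X' := by
  simp only [Hent_eq_sum, probOf, h]

/-- Strong subadditivity of entropy. -/
lemma Hent_submodular [Fintype α] [Fintype β] [Fintype γ] {p : Ω → ℝ} (hp : IsPMF p)
    (A : Ω → α) (B : Ω → β) (C : Ω → γ) :
    Hent p (fun ω => (A ω, B ω, C ω)) + Hent p C ≤
      Hent p (fun ω => (A ω, C ω)) + Hent p (fun ω => (B ω, C ω)) := by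
  set pABC := probOf p (fun ω => (A ω, B ω, C ω)) with hABC
  set pAC := probOf p (fun ω => (A ω, C ω)) with hAC
  set pBC := probOf p (fun ω => (B ω, C ω)) with hBC
  set pC := probOf p C with hC
  let r : α × β × γ → ℝ := fun x => pAC (x.1, x.2.2) * pBC x.2 / (pABC x * pC x.2.2)
  have hr : ∑ ω, p ω * r (A ω, B ω, C ω) ≤ 1 := by
    rw [← sum_probOf_mul p (fun ω => (A ω, B ω, C ω)) r]
    calc ∑ x, pABC x * r x
        ≤ ∑ x : α × β × γ, pAC (x.1, x.2.2) * pBC x.2 / pC x.2.2 := by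
          refine Finset.sum_le_sum fun x _ => ?_
          have h1 : 0 ≤ pAC (x.1, x.2.2) * pBC x.2 / pC x.2.2 :=
            div_nonneg (mul_nonneg (probOf_nonneg hp _ _) (probOf_nonneg hp _ _))
              (probOf_nonneg hp _ _)
          by_cases h : pABC x = 0
          · simpa [h] using h1
          · refine le_of_eq ?_
            simp only [r]
            rw [← mul_div_assoc, mul_div_mul_left _ _ h]
      _ = ∑ c, pC c * pC c / pC c := by
          rw [Fintype.sum_prod_type]
          simp only [Fintype.sum_prod_type_right (γ := ℝ)]
          rw [Finset.sum_comm]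
          refine Finset.sum_congr rfl fun c _ => ?_
          simp only [← Finset.sum_div, ← Finset.mul_sum, ← Finset.sum_mul]
          rw [hAC, hBC, sum_probOf_prodMk, sum_probOf_prodMk]
      _ = 1 := by simp only [mul_self_div_self]; exact sum_probOf hp C
  have hlog : ∀ ω, p ω * (1 - r (A ω, B ω, C ω)) ≤
      p ω * Real.log (pABC (A ω, B ω, C ω)) + p ω * Real.log (pC (C ω))
        - p ω * Real.log (pAC (A ω, C ω)) - p ω * Real.log (pBC (B ω, C ω)) := by
    intro ω
    rcases (hp.1 ω).eq_or_lt with h | h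
    · simp [← h]
    have h1 : 0 < pABC (A ω, B ω, C ω) := probOf_pos hp (fun ω => (A ω, B ω, C ω)) h
    have h2 : 0 < pC (C ω) := probOf_pos hp C h
    have h3 : 0 < pAC (A ω, C ω) := probOf_pos hp (fun ω => (A ω, C ω)) h
    have h4 : 0 < pBC (B ω, C ω) := probOf_pos hp (fun ω => (B ω, C ω)) h
    have h5 := Real.log_le_sub_one_of_pos (div_pos (mul_pos h3 h4) (mul_pos h1 h2))
    rw [Real.log_div (mul_pos h3 h4).ne' (mul_pos h1 h2).ne', Real.log_mul h3.ne' h4.ne',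
      Real.log_mul h1.ne' h2.ne'] at h5
    simp only [r]
    nlinarith [mul_le_mul_of_nonneg_left h5 h.le]
  have hsum := Finset.sum_le_sum fun ω (_ : ω ∈ Finset.univ) => hlog ω
  simp only [mul_sub, mul_one, Finset.sum_sub_distrib, Finset.sum_add_distrib, hp.2] at hsum
  simp only [Hent_eq_sum]
  linarith

end Entropy

section Tuples

lemma tup_eq_iff {Ω ι : Type} {𝒳 : ι → Type} (X : ∀ k, Ω → 𝒳 k) (S : Finset ι) (ω ω' : Ω) :
    tup X S ω = tup X S ω' ↔ ∀ k ∈ S, X k ω = X k ω' := by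
  simp [tup, funext_iff]

variable {Ω ι β : Type} [Fintype Ω] [Fintype β] [DecidableEq ι]
  {𝒳 : ι → Type} [∀ k, Fintype (𝒳 k)]

lemma Hent_tup_submodular {p : Ω → ℝ} (hp : IsPMF p) (X : ∀ k, Ω → 𝒳 k) (W : Ω → β)
    (S T : Finset ι) :
    Hent p (fun ω => (tup X (S ∪ T) ω, W ω)) + Hent p (fun ω => (tup X (S ∩ T) ω, W ω)) ≤
      Hent p (fun ω => (tup X S ω, W ω)) + Hent p (fun ω => (tup X T ω, W ω)) := by
  convert Hent_submodular hp (tup X S) (tup X T) (fun ω => (tup X (S ∩ T) ω, W ω)) using 2 <;>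
  · refine Hent_congr p fun ω ω' => ?_
    simp only [Prod.mk.injEq, tup_eq_iff, Finset.mem_union, Finset.mem_inter]
    grind

lemma IcondMut_tup (p : Ω → ℝ) (X : ∀ k, Ω → 𝒳 k) (Y : Ω → β) (A C : Finset ι) :
    IcondMut p (tup X A) Y (tup X C) =
      Hent p (tup X (A ∪ C)) + Hent p (fun ω => (tup X C ω, Y ω))
        - Hent p (tup X C) - Hent p (fun ω => (tup X (A ∪ C) ω, Y ω)) := by
  have h1 : Hent p (fun ω => (tup X A ω, tup X C ω)) = Hent p (tup X (A ∪ C)) :=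
    Hent_congr p fun ω ω' => by
      simp only [Prod.mk.injEq, tup_eq_iff, Finset.mem_union]; grind
  have h2 : Hent p (fun ω => (Y ω, tup X C ω)) = Hent p (fun ω => (tup X C ω, Y ω)) :=
    Hent_congr p fun ω ω' => by simp only [Prod.mk.injEq, and_comm]
  have h3 : Hent p (fun ω => ((tup X A ω, Y ω), tup X C ω)) =
      Hent p (fun ω => (tup X (A ∪ C) ω, Y ω)) :=
    Hent_congr p fun ω ω' => by
      simp only [Prod.mk.injEq, tup_eq_iff, Finset.mem_union]; grind
  simp only [IcondMut, condHent, h1, h2, h3]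
  ring

lemma Hent_tup_empty {p : Ω → ℝ} (hp : IsPMF p) (X : ∀ k, Ω → 𝒳 k) :
    Hent p (tup X ∅) = 0 := by
  have h : ∀ ω, probOf p (tup X ∅) (tup X ∅ ω) = 1 := fun ω => by
    simp [probOf, tup_eq_iff, hp.2]
  simp [Hent_eq_sum, h]

lemma Hent_tup_union_le {p : Ω → ℝ} (hp : IsPMF p) (X : ∀ k, Ω → 𝒳 k) {S T : Finset ι}
    (h : Disjoint S T) : Hent p (tup X (S ∪ T)) ≤ Hent p (tup X S) + Hent p (tup X T) := by
  have hW : ∀ R : Finset ι, Hent p (fun ω => (tup X R ω, ())) = Hent p (tup X R) :=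
    fun R => Hent_congr p fun ω ω' => by simp
  have := Hent_tup_submodular hp X (fun _ => ()) S T
  rw [Finset.disjoint_iff_inter_eq_empty.1 h] at this
  simpa [hW, Hent_tup_empty hp] using this

lemma Hent_tup_le_sum {p : Ω → ℝ} (hp : IsPMF p) (X : ∀ k, Ω → 𝒳 k) (S : Finset ι) :
    Hent p (tup X S) ≤ ∑ k ∈ S, Hent p (X k) := by
  induction S using Finset.induction_on with
  | empty => simp [Hent_tup_empty hp]
  | insert k S hk ih =>
    have h1 : Hent p (tup X {k}) = Hent p (X k) :=
      Hent_congr p fun ω ω' => by simp [tup_eq_iff]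
    have := Hent_tup_union_le hp X (Finset.disjoint_singleton_left.2 hk)
    rw [Finset.sum_insert hk, Finset.insert_eq]
    linarith

lemma MutIndep.Hent_tup_univ [Fintype ι] {p : Ω → ℝ} (hp : IsPMF p) {X : ∀ k, Ω → 𝒳 k}
    (hind : MutIndep p X) : Hent p (tup X Finset.univ) = ∑ k, Hent p (X k) := by
  have h1 : Hent p (tup X Finset.univ) = Hent p (fun ω k => X k ω) :=
    Hent_congr p fun ω ω' => by rw [tup_eq_iff, funext_iff]; simp
  simp only [h1, Hent_eq_sum, Finset.sum_neg_distrib]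
  rw [Finset.sum_comm]
  congr 1
  refine Finset.sum_congr rfl fun ω _ => ?_
  rcases (hp.1 ω).eq_or_lt with h | h
  · simp [← h]
  · rw [hind, Real.log_prod fun k _ => (probOf_pos hp (X k) h).ne', Finset.mul_sum]

lemma MutIndep.Hent_tup [Fintype ι] {p : Ω → ℝ} (hp : IsPMF p) {X : ∀ k, Ω → 𝒳 k}
    (hind : MutIndep p X) (S : Finset ι) : Hent p (tup X S) = ∑ k ∈ S, Hent p (X k) := by
  refine le_antisymm (Hent_tup_le_sum hp X S) ?_
  have h1 := Hent_tup_union_le hp X (disjoint_compl_right (a := S))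
  rw [Finset.union_compl, hind.Hent_tup_univ hp] at h1
  have h2 := Hent_tup_le_sum hp X Sᶜ
  have h3 := Finset.sum_add_sum_compl S fun k => Hent p (X k)
  linarith

/-- For independent inputs and disjoint `A`, `C`, only `H(X_A)` and the joint entropies with the
output remain in `I(X_A;Y | X_C)`. -/
lemma MutIndep.IcondMut_tup [Fintype ι] {p : Ω → ℝ} (hp : IsPMF p) {X : ∀ k, Ω → 𝒳 k}
    (hind : MutIndep p X) (Y : Ω → β) {A C : Finset ι} (h : Disjoint A C) :
    IcondMut p (tup X A) Y (tup X C) =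
      ∑ k ∈ A, Hent p (X k) + Hent p (fun ω => (tup X C ω, Y ω))
        - Hent p (fun ω => (tup X (A ∪ C) ω, Y ω)) := by
  rw [_root_.IcondMut_tup, hind.Hent_tup hp, hind.Hent_tup hp, Finset.sum_union h]
  ring

end Tuples

theorem stmt13 {K : ℕ} (hK : 1 ≤ K) {Ω : Type} [Fintype Ω]
    {𝒳 : Fin K → Type} [∀ k, Fintype (𝒳 k)] {𝒴 𝒵 : Type} [Fintype 𝒴] [Fintype 𝒵]
    (p : Ω → ℝ) (hp : IsPMF p)
    (X : ∀ k, Ω → 𝒳 k) (Y : Ω → 𝒴) (Z : Ω → 𝒵) (hind : MutIndep p X)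
    (K₀ K' : Finset (Fin K)) (hK₀ : K₀ ⊆ K')
    (h1 : IcondMut p (tup X K₀) Y (tup X (Finset.univ \ K₀)) -
            IcondMut p (tup X K₀) Z (tup X (Finset.univ \ K')) ≤ 0) :
    ∀ V ⊆ K' \ K₀, V.Nonempty →
      IcondMut p (tup X (K₀ ∪ V)) Y (tup X (Finset.univ \ (K₀ ∪ V))) -
          IcondMut p (tup X (K₀ ∪ V)) Z (tup X (Finset.univ \ K')) ≤
        IcondMut p (tup X V) Y (tup X (Finset.univ \ V)) -
          IcondMut p (tup X V) Z (tup X ((Finset.univ \ K') ∪ K₀)) := by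
  intro V hV _
  have hVd : Disjoint K₀ V := by rw [Finset.disjoint_left]; grind
  have hd1 : Disjoint K₀ (Finset.univ \ K') := by rw [Finset.disjoint_left]; grind
  have hd2 : Disjoint (K₀ ∪ V) (Finset.univ \ K') := by rw [Finset.disjoint_left]; grind
  have hd3 : Disjoint V ((Finset.univ \ K') ∪ K₀) := by rw [Finset.disjoint_left]; grind
  rw [hind.IcondMut_tup hp Y Finset.disjoint_sdiff, hind.IcondMut_tup hp Z hd1,
    Finset.union_sdiff_of_subset (Finset.subset_univ _)] at h1
  rw [hind.IcondMut_tup hp Y Finset.disjoint_sdiff, hind.IcondMut_tup hp Z hd2,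
    hind.IcondMut_tup hp Y Finset.disjoint_sdiff, hind.IcondMut_tup hp Z hd3,
    Finset.union_sdiff_of_subset (Finset.subset_univ _),
    Finset.union_sdiff_of_subset (Finset.subset_univ _)]
  have hsub := Hent_tup_submodular hp X Y (Finset.univ \ K₀) (Finset.univ \ V)
  have e1 : (Finset.univ \ K₀) ∪ (Finset.univ \ V) = Finset.univ := by
    rw [Finset.disjoint_left] at hVd; ext k; simpa [← imp_iff_not_or] using @hVd k
  have e2 : (Finset.univ \ K₀) ∩ (Finset.univ \ V) = Finset.univ \ (K₀ ∪ V) :=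
    (Finset.sdiff_union_distrib _ _ _).symm
  have e3 : V ∪ ((Finset.univ \ K') ∪ K₀) = (K₀ ∪ V) ∪ (Finset.univ \ K') := by
    ext; simp only [Finset.mem_union]; tauto
  rw [e1, e2] at hsub
  rw [e3, Finset.union_comm (Finset.univ \ K') K₀]
  linarith
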